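/- Let f : ℝ → [0,∞) be measurable with ∫_ℝ f(λ)⁴ dλ < ∞, and let ψ : ℝ → ℝ be integrable with integrable Fourier transform ψ̂. Then for every s > 0: s² ∫_{ℝ²} f(λ₁) f(λ₂) ( ∫_ℝ |ψ̂(s(λ₁+η))| · |ψ̂(s(λ₂−η))| · f(η) dη )² dλ₁ dλ₂ ≤ s^{−1} · ‖f‖_{L⁴}⁴ · ‖ψ̂‖_{L¹}³ · ‖ψ̂‖_{L^∞}. -/

import Mathlib

open MeasureTheory

/-- The Fourier transform `ψ̂(λ) = ∫ e^{-iuλ} ψ(u) du` of an integrable `ψ : ℝ → ℝ`. -/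
noncomputable def Fhat (ψ : ℝ → ℝ) (l : ℝ) : ℂ :=
  ∫ u : ℝ, Complex.exp (-Complex.I * u * l) * (ψ u : ℂ)

lemma continuous_Fhat {ψ : ℝ → ℝ} (hψ : Integrable ψ) : Continuous (Fhat ψ) := by
  unfold Fhat
  refine continuous_of_dominated (bound := fun u => ‖ψ u‖) (fun l => ?_) (fun l => ?_) hψ.norm ?_
  · exact (by fun_prop : Continuous fun u : ℝ =>
      Complex.exp (-Complex.I * u * l)).aestronglyMeasurable.mul hψ.ofReal.aestronglyMeasurable
  · refine Filter.Eventually.of_forall fun u => ?_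
    have h : -Complex.I * u * l = ((-(u * l) : ℝ) : ℂ) * Complex.I := by push_cast; ring
    rw [norm_mul, h, Complex.norm_exp_ofReal_mul_I, one_mul, Complex.norm_real]
  · exact Filter.Eventually.of_forall fun u => by fun_prop

lemma Continuous.enorm_le_eLpNorm_top {g : ℝ → ℂ} (hg : Continuous g) (x : ℝ) :
    ‖g x‖ₑ ≤ eLpNorm g ⊤ volume := by
  have hopen : IsOpen {y | eLpNorm g ⊤ volume < ‖g y‖ₑ} :=
    isOpen_lt continuous_const hg.enorm
  have hnull : volume {y | eLpNorm g ⊤ volume < ‖g y‖ₑ} = 0 := by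
    have h := enorm_ae_le_eLpNormEssSup g volume
    rw [← eLpNorm_exponent_top, ae_iff] at h
    simpa only [not_le] using h
  by_contra! hx
  exact Set.notMem_empty x ((hopen.measure_eq_zero_iff volume).1 hnull ▸ hx)

lemma ENNReal.four_mul_le_sum_pow_four (a b c d : ENNReal) :
    4 * (a * b * c * d) ≤ a ^ 4 + b ^ 4 + c ^ 4 + d ^ 4 := by
  by_cases ha : a = ⊤
  · simp [ha]
  by_cases hb : b = ⊤
  · simp [hb]
  by_cases hc : c = ⊤
  · simp [hc]
  by_cases hd : d = ⊤
  · simp [hd]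
  lift a to NNReal using ha
  lift b to NNReal using hb
  lift c to NNReal using hc
  lift d to NNReal using hd
  norm_cast
  rw [← NNReal.coe_le_coe]
  push_cast
  nlinarith [sq_nonneg ((a : ℝ) ^ 2 - b ^ 2), sq_nonneg ((c : ℝ) ^ 2 - d ^ 2),
    sq_nonneg ((a : ℝ) * b - c * d)]

section Contraction

variable {F G : ℝ → ENNReal}

lemma lintegral_kernel_le (hG : Measurable G) {C : ENNReal} (hC : ∀ x, G x ≤ C) (x y a : ℝ) :
    ∫⁻ b, G (x + a) * G (y - a) * (G (x + b) * G (y - b)) ≤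
      G (x + a) * G (y - a) * (C * ∫⁻ u, G u) := by
  rw [lintegral_const_mul _ (by fun_prop)]
  gcongr
  calc ∫⁻ b, G (x + b) * G (y - b) ≤ ∫⁻ b, G (x + b) * C := by
        gcongr with b
        exact hC _
    _ = C * ∫⁻ u, G u := by
        rw [lintegral_mul_const _ (by fun_prop), lintegral_add_left_eq_self, mul_comm]

lemma four_mul_contraction_sq_le (hF : Measurable F) (hG : Measurable G) {C : ENNReal}
    (hC : ∀ x, G x ≤ C) (x y : ℝ) :
    4 * (F x * F y * (∫⁻ a, G (x + a) * G (y - a) * F a) ^ 2) ≤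
      (∫⁻ a, (F x ^ 4 + F y ^ 4 + 2 * F a ^ 4) * (G (x + a) * G (y - a))) *
        (C * ∫⁻ u, G u) := by
  set W : ℝ → ℝ → ENNReal :=
    fun a b => G (x + a) * G (y - a) * (G (x + b) * G (y - b)) with hW
  have hWm : Measurable (Function.uncurry W) := by
    simp only [hW, Function.uncurry_def]; fun_prop
  have hWa : ∀ a, Measurable (W a) := fun a => by simp only [hW]; fun_prop
  have hWs : ∀ a b, W a b = W b a := fun a b => by simp only [hW]; ring
  have hswap : ∫⁻ a, ∫⁻ b, F b ^ 4 * W a b = ∫⁻ a, F a ^ 4 * ∫⁻ b, W a b := by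
    rw [lintegral_lintegral_swap (by simp only [hW, Function.uncurry_def]; fun_prop)]
    refine lintegral_congr fun b => ?_
    simp_rw [hWs _ b]
    exact lintegral_const_mul _ (hWa b)
  have hWi : Measurable fun a => ∫⁻ b, W a b := hWm.lintegral_prod_right'
  calc 4 * (F x * F y * (∫⁻ a, G (x + a) * G (y - a) * F a) ^ 2)
      = ∫⁻ a, ∫⁻ b, 4 * (F x * F y * F a * F b) * W a b := by
        rw [sq, ← mul_assoc, ← mul_assoc, ← lintegral_const_mul _ (by fun_prop)]
        refine lintegral_congr fun a => ?_
        rw [mul_right_comm, ← lintegral_const_mul _ (by fun_prop)]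
        refine lintegral_congr fun b => ?_
        simp only [hW]; ring
    _ ≤ ∫⁻ a, ∫⁻ b, ((F x ^ 4 + F y ^ 4 + F a ^ 4) * W a b + F b ^ 4 * W a b) := by
        gcongr with a b
        rw [← add_mul]
        gcongr
        exact ENNReal.four_mul_le_sum_pow_four _ _ _ _
    _ = ∫⁻ a, (F x ^ 4 + F y ^ 4 + 2 * F a ^ 4) * ∫⁻ b, W a b := by
        have hsplit : ∀ a, ∫⁻ b, ((F x ^ 4 + F y ^ 4 + F a ^ 4) * W a b + F b ^ 4 * W a b) =
            (F x ^ 4 + F y ^ 4 + F a ^ 4) * (∫⁻ b, W a b) + ∫⁻ b, F b ^ 4 * W a b := fun a => by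
          rw [lintegral_add_left (by fun_prop), lintegral_const_mul _ (hWa a)]
        rw [lintegral_congr hsplit, lintegral_add_left (by fun_prop), hswap, ← lintegral_add_left (by fun_prop)]
        refine lintegral_congr fun a => ?_
        ring
    _ ≤ ∫⁻ a, (F x ^ 4 + F y ^ 4 + 2 * F a ^ 4) *
          (G (x + a) * G (y - a) * (C * ∫⁻ u, G u)) := by
        gcongr with a
        exact lintegral_kernel_le hG hC x y a
    _ = _ := by
        rw [← lintegral_mul_const _ (by fun_prop)]
        refine lintegral_congr fun a => ?_
        ring

lemma lintegral_weight_fst {Φ : ℝ → ENNReal} (hΦ : Measurable Φ) (hG : Measurable G) :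
    ∫⁻ x, ∫⁻ y, ∫⁻ a, Φ x * (G (x + a) * G (y - a)) = (∫⁻ u, Φ u) * (∫⁻ u, G u) ^ 2 := by
  rw [← lintegral_mul_const _ hΦ]
  refine lintegral_congr fun x => ?_
  rw [lintegral_lintegral_swap (by simp only [Function.uncurry_def]; fun_prop)]
  calc ∫⁻ a, ∫⁻ y, Φ x * (G (x + a) * G (y - a))
      = ∫⁻ a, Φ x * G (x + a) * ∫⁻ u, G u := by
        refine lintegral_congr fun a => ?_
        simp_rw [← mul_assoc]
        rw [lintegral_const_mul _ (by fun_prop), lintegral_sub_right_eq_self]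
    _ = Φ x * (∫⁻ u, G u) ^ 2 := by
        rw [lintegral_mul_const _ (by fun_prop), lintegral_const_mul _ (by fun_prop),
          lintegral_add_left_eq_self, sq, mul_assoc]

lemma lintegral_weight_snd {Φ : ℝ → ENNReal} (hΦ : Measurable Φ) (hG : Measurable G) :
    ∫⁻ x, ∫⁻ y, ∫⁻ a, Φ y * (G (x + a) * G (y - a)) = (∫⁻ u, Φ u) * (∫⁻ u, G u) ^ 2 := by
  rw [lintegral_lintegral_swap (by simp only [Function.uncurry_def]; fun_prop),
    ← lintegral_weight_fst hΦ hG]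
  refine lintegral_congr fun y => lintegral_congr fun x => ?_
  rw [← lintegral_neg_eq_self]
  refine lintegral_congr fun a => ?_
  rw [sub_neg_eq_add, ← sub_eq_add_neg, mul_comm (G (x - a))]

lemma lintegral_weight_mid {Φ : ℝ → ENNReal} (hΦ : Measurable Φ) (hG : Measurable G) :
    ∫⁻ x, ∫⁻ y, ∫⁻ a, Φ a * (G (x + a) * G (y - a)) = (∫⁻ u, Φ u) * (∫⁻ u, G u) ^ 2 := by
  calc ∫⁻ x, ∫⁻ y, ∫⁻ a, Φ a * (G (x + a) * G (y - a))
      = ∫⁻ x, ∫⁻ a, Φ a * G (x + a) * ∫⁻ u, G u := by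
        refine lintegral_congr fun x => ?_
        rw [lintegral_lintegral_swap (by simp only [Function.uncurry_def]; fun_prop)]
        refine lintegral_congr fun a => ?_
        simp_rw [← mul_assoc]
        rw [lintegral_const_mul _ (by fun_prop), lintegral_sub_right_eq_self]
    _ = ∫⁻ a, Φ a * (∫⁻ u, G u) ^ 2 := by
        rw [lintegral_lintegral_swap (by simp only [Function.uncurry_def]; fun_prop)]
        refine lintegral_congr fun a => ?_
        rw [lintegral_mul_const _ (by fun_prop), lintegral_const_mul _ (by fun_prop),
          lintegral_add_right_eq_self, sq, mul_assoc]
    _ = _ := lintegral_mul_const _ hΦ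

lemma lintegral_contraction_sq_le (hF : Measurable F) (hG : Measurable G) {C : ENNReal}
    (hC : ∀ x, G x ≤ C) :
    ∫⁻ p : ℝ × ℝ, F p.1 * F p.2 * (∫⁻ a, G (p.1 + a) * G (p.2 - a) * F a) ^ 2 ≤
      (∫⁻ u, F u ^ 4) * (∫⁻ u, G u) ^ 3 * C := by
  have hF4 : Measurable fun u => F u ^ 4 := by fun_prop
  refine (ENNReal.mul_le_mul_iff_right (a := 4) (by norm_num) (by norm_num)).1 ?_
  rw [Measure.volume_eq_prod, lintegral_prod _ (by fun_prop)]
  rw [← lintegral_const_mul _ (by fun_prop)]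
  calc ∫⁻ x, 4 * ∫⁻ y, F x * F y * (∫⁻ a, G (x + a) * G (y - a) * F a) ^ 2
      ≤ ∫⁻ x, ∫⁻ y, (∫⁻ a, (F x ^ 4 + F y ^ 4 + 2 * F a ^ 4) * (G (x + a) * G (y - a))) *
        (C * ∫⁻ u, G u) := by
        gcongr with x
        rw [← lintegral_const_mul _ (by fun_prop)]
        refine lintegral_mono fun y => ?_
        exact four_mul_contraction_sq_le hF hG hC x y
    _ = ((∫⁻ x, ∫⁻ y, ∫⁻ a, F x ^ 4 * (G (x + a) * G (y - a))) +
          (∫⁻ x, ∫⁻ y, ∫⁻ a, F y ^ 4 * (G (x + a) * G (y - a))) +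
          2 * ∫⁻ x, ∫⁻ y, ∫⁻ a, F a ^ 4 * (G (x + a) * G (y - a))) * (C * ∫⁻ u, G u) := by
        generalize C * ∫⁻ u, G u = D
        rw [← lintegral_const_mul _ (by fun_prop), ← lintegral_add_left (by fun_prop),
          ← lintegral_add_left (by fun_prop), ← lintegral_mul_const _ (by fun_prop)]
        refine lintegral_congr fun x => ?_
        rw [lintegral_mul_const _ (by fun_prop), ← lintegral_const_mul _ (by fun_prop),
          ← lintegral_add_left (by fun_prop), ← lintegral_add_left (by fun_prop)]
        congr 1
        refine lintegral_congr fun y => ?_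
        rw [← lintegral_const_mul _ (by fun_prop),
          ← lintegral_add_left (by fun_prop), ← lintegral_add_left (by fun_prop)]
        refine lintegral_congr fun a => ?_
        ring
    _ = _ := by
        rw [lintegral_weight_fst hF4 hG, lintegral_weight_snd hF4 hG,
          lintegral_weight_mid hF4 hG]
        ring

end Contraction

/-- If `f : ℝ → [0,∞)` is measurable with `∫ f⁴ < ∞` and `ψ, ψ̂ ∈ L¹`, then for
every `s > 0`:
`s² ∫ f(λ₁)f(λ₂) (∫ |ψ̂(s(λ₁+η))||ψ̂(s(λ₂−η))| f(η) dη)² dλ₁ dλ₂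
  ≤ s⁻¹ ‖f‖_{L⁴}⁴ ‖ψ̂‖_{L¹}³ ‖ψ̂‖_{L^∞}`. -/
theorem stmt16 (f : ℝ → ℝ) (hfnn : ∀ l : ℝ, 0 ≤ f l) (hfm : Measurable f)
    (hf4 : ∫⁻ l : ℝ, ENNReal.ofReal ((f l) ^ 4) < ⊤)
    (ψ : ℝ → ℝ) (hψ : Integrable ψ) (hψhat : Integrable (Fhat ψ)) :
    ∀ s : ℝ, 0 < s →
      ENNReal.ofReal (s ^ 2) *
        ∫⁻ p : ℝ × ℝ,
          ENNReal.ofReal (f p.1 * f p.2) *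
            (∫⁻ η : ℝ, ENNReal.ofReal
              (‖Fhat ψ (s * (p.1 + η))‖ * ‖Fhat ψ (s * (p.2 - η))‖ * f η)) ^ 2
      ≤ ENNReal.ofReal s⁻¹ * (∫⁻ l : ℝ, ENNReal.ofReal ((f l) ^ 4)) *
          (∫⁻ u : ℝ, ENNReal.ofReal ‖Fhat ψ u‖) ^ 3 *
          eLpNorm (Fhat ψ) ⊤ volume := by
  intro s hs
  have hcont : Continuous (Fhat ψ) := continuous_Fhat hψ
  set F : ℝ → ENNReal := fun l => ENNReal.ofReal (f l) with hF
  set G : ℝ → ENNReal := fun x => ENNReal.ofReal ‖Fhat ψ (s * x)‖ with hG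
  have hFm : Measurable F := hfm.ennreal_ofReal
  have hGm : Measurable G := by
    have : Continuous fun x => ‖Fhat ψ (s * x)‖ := by fun_prop
    exact this.measurable.ennreal_ofReal
  have hGC : ∀ x, G x ≤ eLpNorm (Fhat ψ) ⊤ volume := fun x => by
    simp only [hG, ofReal_norm]
    exact hcont.enorm_le_eLpNorm_top _
  have hGint : ∫⁻ x, G x = ENNReal.ofReal s⁻¹ * ∫⁻ u, ENNReal.ofReal ‖Fhat ψ u‖ := by
    have hm : Measurable fun u => ENNReal.ofReal ‖Fhat ψ u‖ :=
      hcont.norm.measurable.ennreal_ofReal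
    have h := lintegral_map (μ := volume) hm (measurable_const_mul s)
    rw [Real.map_volume_mul_left hs.ne', lintegral_smul_measure, abs_of_pos (inv_pos.2 hs)] at h
    exact h.symm
  have hF4 : ∀ l, ENNReal.ofReal (f l ^ 4) = F l ^ 4 := fun l => ENNReal.ofReal_pow (hfnn l) 4
  have hker : ∀ x y η : ℝ, ENNReal.ofReal
      (‖Fhat ψ (s * (x + η))‖ * ‖Fhat ψ (s * (y - η))‖ * f η) =
        G (x + η) * G (y - η) * F η := fun x y η => by
    rw [ENNReal.ofReal_mul (by positivity), ENNReal.ofReal_mul (by positivity)]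
  have hscale : ENNReal.ofReal (s ^ 2) * ENNReal.ofReal s⁻¹ ^ 3 = ENNReal.ofReal s⁻¹ := by
    rw [← ENNReal.ofReal_pow (by positivity), ← ENNReal.ofReal_mul (by positivity)]
    congr 1
    field_simp
  simp_rw [hF4, hker, ENNReal.ofReal_mul (hfnn _)]
  calc _ ≤ ENNReal.ofReal (s ^ 2) *
        ((∫⁻ u, F u ^ 4) * (∫⁻ u, G u) ^ 3 * eLpNorm (Fhat ψ) ⊤ volume) := by
        gcongr
        exact lintegral_contraction_sq_le hFm hGm hGC
    _ = ENNReal.ofReal (s ^ 2) * ENNReal.ofReal s⁻¹ ^ 3 * (∫⁻ u, F u ^ 4) *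
          (∫⁻ u, ENNReal.ofReal ‖Fhat ψ u‖) ^ 3 * eLpNorm (Fhat ψ) ⊤ volume := by
        rw [hGint]; ring
    _ = _ := by rw [hscale]
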